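/- A finite nilpotent group G, written as the direct product of its Sylow subgroups, can uniquely be written as the union of three proper subgroups if and only if its Sylow 2-subgroup is nontrivial and generated by exactly two elements (i.e., has Frattini index 4). -/

import Mathlib

namespace Subgroup

variable {G : Type*} [Group G]

/-- The elements on which two index-two subgroups agree; for distinct subgroups this is the third
index-two subgroup containing their intersection. -/
def agreement (H K : Subgroup G) (hH : H.index = 2) (hK : K.index = 2) : Subgroup G where
  carrier := {x | x ∈ H ↔ x ∈ K}
  one_mem' := by simp
  mul_mem' {a b} ha hb := by
    simp only [Set.mem_ofPred_eq, mul_mem_iff_of_index_two hH, mul_mem_iff_of_index_two hK] at *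
    tauto
  inv_mem' := by simp

variable {H K : Subgroup G}

theorem mem_agreement {hH : H.index = 2} {hK : K.index = 2} {x : G} :
    x ∈ agreement H K hH hK ↔ (x ∈ H ↔ x ∈ K) := Iff.rfl

theorem ne_top_of_index_eq_two (hH : H.index = 2) : H ≠ ⊤ := by
  rintro rfl
  simp at hH

theorem index_agreement (hH : H.index = 2) (hK : K.index = 2) (hne : H ≠ K) :
    (agreement H K hH hK).index = 2 := by
  obtain ⟨a, ha⟩ : ∃ a, ¬ (a ∈ H ↔ a ∈ K) := by
    by_contra! h
    exact hne (Subgroup.ext h)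
  refine index_eq_two_iff_exists_notMem_and.2 ⟨a, ha, fun b ↦ ?_⟩
  simp only [mem_agreement, mul_mem_iff_of_index_two hH, mul_mem_iff_of_index_two hK]
  tauto

theorem agreement_ne_left (hH : H.index = 2) (hK : K.index = 2) : agreement H K hH hK ≠ H := by
  intro h
  refine ne_top_of_index_eq_two hK ((eq_top_iff' K).2 fun x ↦ ?_)
  have hx : (x ∈ H ↔ x ∈ K) ↔ x ∈ H := by rw [← mem_agreement (hH := hH) (hK := hK), h]
  tauto

theorem agreement_ne_right (hH : H.index = 2) (hK : K.index = 2) : agreement H K hH hK ≠ K := by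
  intro h
  refine ne_top_of_index_eq_two hH ((eq_top_iff' H).2 fun x ↦ ?_)
  have hx : (x ∈ H ↔ x ∈ K) ↔ x ∈ K := by rw [← mem_agreement (hH := hH) (hK := hK), h]
  tauto

theorem inf_le_agreement (hH : H.index = 2) (hK : K.index = 2) :
    H ⊓ K ≤ agreement H K hH hK := fun x hx ↦ by
  obtain ⟨h₁, h₂⟩ := mem_inf.1 hx
  exact mem_agreement.2 ⟨fun _ ↦ h₂, fun _ ↦ h₁⟩

theorem union_agreement (hH : H.index = 2) (hK : K.index = 2) :
    (H : Set G) ∪ K ∪ agreement H K hH hK = Set.univ := by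
  ext x
  simp only [Set.mem_union, SetLike.mem_coe, mem_agreement, Set.mem_univ, iff_true]
  tauto

theorem exists_notMem_and_notMem (hH : H ≠ ⊤) (hK : K ≠ ⊤) : ∃ x, x ∉ H ∧ x ∉ K := by
  by_contra! h
  obtain ⟨a, ha⟩ : ∃ a, a ∉ H := by simpa [eq_top_iff'] using hH
  obtain ⟨b, hb⟩ : ∃ b, b ∉ K := by simpa [eq_top_iff'] using hK
  have hbH : b ∈ H := by
    by_contra hbH
    exact hb (h b hbH)
  by_cases hab : a * b ∈ H
  · exact ha ((mul_mem_cancel_right hbH).1 hab)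
  · exact hb ((mul_mem_cancel_left (h a ha)).1 (h _ hab))

/-- In a covering by three proper subgroups, the first has index two. -/
theorem index_eq_two_of_union_eq_univ {A B C : Subgroup G} (hA : A ≠ ⊤) (hB : B ≠ ⊤) (hC : C ≠ ⊤)
    (h : (A : Set G) ∪ B ∪ C = Set.univ) : A.index = 2 := by
  have cover (x : G) : x ∈ A ∨ x ∈ B ∨ x ∈ C := by
    have : x ∈ (A : Set G) ∪ B ∪ C := h ▸ Set.mem_univ x
    simpa [or_assoc] using this
  have inter {X Y Z : Subgroup G} (hX : X ≠ ⊤) (hY : Y ≠ ⊤)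
      (hc : ∀ x, x ∈ X ∨ x ∈ Y ∨ x ∈ Z) {x : G} (h₁ : x ∈ X) (h₂ : x ∈ Y) : x ∈ Z := by
    obtain ⟨y, hyX, hyY⟩ := exists_notMem_and_notMem hX hY
    have hyZ : y ∈ Z := by have := hc y; tauto
    have hxy : x * y ∈ Z := by
      have := hc (x * y)
      rw [mul_mem_cancel_left h₁, mul_mem_cancel_left h₂] at this
      tauto
    exact (mul_mem_cancel_right hyZ).1 hxy
  have hAB {x : G} : x ∈ A → x ∈ B → x ∈ C := inter hA hB cover
  have hAC {x : G} : x ∈ A → x ∈ C → x ∈ B :=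
    inter hA hC fun x ↦ by have := cover x; tauto
  have hBC {x : G} : x ∈ B → x ∈ C → x ∈ A :=
    inter hB hC fun x ↦ by have := cover x; tauto
  obtain ⟨c, hcA, hcB⟩ := exists_notMem_and_notMem hA hB
  have hcC : c ∈ C := by have := cover c; tauto
  obtain ⟨b, hbA, hbC⟩ := exists_notMem_and_notMem hA hC
  have hbB : b ∈ B := by have := cover b; tauto
  have mixed {x y : G} (hxA : x ∉ A) (hyA : y ∉ A) (hx : x ∈ B) (hy : y ∈ C) : x * y ∈ A := by
    have hyB : y ∉ B := fun h ↦ hyA (hBC h hy)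
    have hxC : x ∉ C := fun h ↦ hxA (hBC hx h)
    have := cover (x * y)
    rw [mul_mem_cancel_left hx, mul_mem_cancel_right hy] at this
    tauto
  refine index_eq_two_iff_exists_notMem_and.2 ⟨c, hcA, fun x ↦ ?_⟩
  by_cases hxA : x ∈ A
  · exact Or.inr hxA
  left
  rcases cover x with hx | hx | hx
  · exact absurd hx hxA
  · exact mixed hxA hcA hx hcC
  · have h₁ : x * b⁻¹ ∈ A := by
      simpa using inv_mem (mixed hbA (fun h ↦ hxA (by simpa using inv_mem h)) hbB (inv_mem hx))
    have h₂ : b * c ∈ A := mixed hbA hcA hbB hcC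
    simpa [mul_assoc] using mul_mem h₁ h₂

theorem eq_of_le_of_index_eq (h : H ≤ K) (hi : H.index = K.index) (h0 : H.index ≠ 0) : H = K := by
  have : H.FiniteIndex := ⟨h0⟩
  exact h.eq_of_not_lt fun hlt ↦ (index_strictAnti hlt).ne' hi

theorem index_inf_eq_four (hH : H.index = 2) (hK : K.index = 2) (hne : H ≠ K) :
    (H ⊓ K).index = 4 := by
  have hle : (H ⊓ K).index ≤ 4 := by simpa [hH, hK] using index_inf_le (H := H) (K := K)
  have hmul := relIndex_mul_index (inf_le_left : H ⊓ K ≤ H)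
  have h0 : (H ⊓ K).index ≠ 0 := index_inf_ne_zero (by omega) (by omega)
  have h2 : (H ⊓ K).index ≠ 2 := fun h2 ↦ hne <|
    (eq_of_le_of_index_eq inf_le_left (h2.trans hH.symm) h0).symm.trans
      (eq_of_le_of_index_eq inf_le_right (h2.trans hK.symm) h0)
  rw [hH] at hmul
  omega

theorem isCoatom_of_index_eq_two (hH : H.index = 2) : IsCoatom H := by
  refine ⟨ne_top_of_index_eq_two hH, fun K hK ↦ ?_⟩
  have : H.FiniteIndex := ⟨by omega⟩
  have hlt := index_strictAnti hK
  have h0 : K.index ≠ 0 := (finiteIndex_of_le hK.le).index_ne_zero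
  exact index_eq_one.1 (by omega)

/-- An index-two subgroup containing the intersection of two others is one of those two or their
agreement subgroup. -/
theorem eq_or_eq_or_eq_agreement_of_inf_le {L : Subgroup G} (hH : H.index = 2) (hK : K.index = 2)
    (hL : L.index = 2) (hne : H ≠ K) (hle : H ⊓ K ≤ L) :
    L = H ∨ L = K ∨ L = agreement H K hH hK := by
  by_cases hLH : L = H
  · exact Or.inl hLH
  by_cases hLK : L = K
  · exact Or.inr (Or.inl hLK)
  right; right
  have h4 := index_inf_eq_four hH hK hne
  have e₁ : H ⊓ K = L ⊓ H := eq_of_le_of_index_eq (le_inf hle inf_le_left)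
    (h4.trans (index_inf_eq_four hL hH hLH).symm) (by omega)
  have e₂ : H ⊓ K = L ⊓ K := eq_of_le_of_index_eq (le_inf hle inf_le_right)
    (h4.trans (index_inf_eq_four hL hK hLK).symm) (by omega)
  refine eq_of_le_of_index_eq (fun x hx ↦ mem_agreement.2 ⟨fun h ↦ ?_, fun h ↦ ?_⟩)
    (hL.trans (index_agreement hH hK hne).symm) (by omega)
  · exact (mem_inf.1 (e₁ ▸ mem_inf.2 ⟨hx, h⟩ : x ∈ H ⊓ K)).2
  · exact (mem_inf.1 (e₂ ▸ mem_inf.2 ⟨hx, h⟩ : x ∈ H ⊓ K)).1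

/-- A group is a union of three proper subgroups in exactly one way iff it has exactly three
subgroups of index two. -/
theorem existsUnique_cover_iff_ncard_index_two_eq_three :
    (∃! S : Set (Subgroup G),
      ∃ H1 H2 H3 : Subgroup G, S = {H1, H2, H3} ∧
        H1 ≠ H2 ∧ H1 ≠ H3 ∧ H2 ≠ H3 ∧
        H1 ≠ ⊤ ∧ H2 ≠ ⊤ ∧ H3 ≠ ⊤ ∧
        (H1 : Set G) ∪ (H2 : Set G) ∪ (H3 : Set G) = Set.univ) ↔
    {H : Subgroup G | H.index = 2}.ncard = 3 := by
  have index_of_cover {A B C : Subgroup G} (hA : A ≠ ⊤) (hB : B ≠ ⊤) (hC : C ≠ ⊤)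
      (h : (A : Set G) ∪ B ∪ C = Set.univ) : A.index = 2 ∧ B.index = 2 ∧ C.index = 2 :=
    ⟨index_eq_two_of_union_eq_univ hA hB hC h,
      index_eq_two_of_union_eq_univ hB hA hC (by rwa [Set.union_comm (B : Set G)]),
      index_eq_two_of_union_eq_univ hC hA hB (by rwa [Set.union_assoc, Set.union_comm])⟩
  constructor
  · rintro ⟨S, ⟨A, B, C, rfl, hAB, hAC, hBC, hA, hB, hC, hu⟩, huniq⟩
    obtain ⟨iA, iB, iC⟩ := index_of_cover hA hB hC hu
    refine Set.ncard_eq_three.2 ⟨A, B, C, hAB, hAC, hBC, Set.Subset.antisymm (fun L hL ↦ ?_) ?_⟩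
    · by_cases hLA : L = A
      · simp [hLA]
      rw [← huniq {L, A, agreement L A hL iA} ⟨L, A, agreement L A hL iA, rfl, hLA,
        (agreement_ne_left hL iA).symm, (agreement_ne_right hL iA).symm,
        ne_top_of_index_eq_two hL, hA, ne_top_of_index_eq_two (index_agreement hL iA hLA),
        union_agreement hL iA⟩]
      simp
    · rintro L (rfl | rfl | rfl) <;> assumption
  · intro h3
    obtain ⟨A, B, C, hAB, -, -, hS⟩ := Set.ncard_eq_three.1 h3
    have iA : A.index = 2 := (Set.ext_iff.1 hS A).2 (by simp)
    have iB : B.index = 2 := (Set.ext_iff.1 hS B).2 (by simp)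
    have hfin : {H : Subgroup G | H.index = 2}.Finite := Set.finite_of_ncard_ne_zero (by omega)
    refine existsUnique_of_exists_of_unique
      ⟨_, A, B, agreement A B iA iB, rfl, hAB, (agreement_ne_left iA iB).symm,
        (agreement_ne_right iA iB).symm, ne_top_of_index_eq_two iA, ne_top_of_index_eq_two iB,
        ne_top_of_index_eq_two (index_agreement iA iB hAB), union_agreement iA iB⟩ ?_
    have key (S : Set (Subgroup G)) (hS : ∃ H1 H2 H3 : Subgroup G, S = {H1, H2, H3} ∧
        H1 ≠ H2 ∧ H1 ≠ H3 ∧ H2 ≠ H3 ∧ H1 ≠ ⊤ ∧ H2 ≠ ⊤ ∧ H3 ≠ ⊤ ∧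
        (H1 : Set G) ∪ (H2 : Set G) ∪ (H3 : Set G) = Set.univ) :
        S = {H : Subgroup G | H.index = 2} := by
      obtain ⟨H1, H2, H3, rfl, h12, h13, h23, h1, h2, h3', hu⟩ := hS
      obtain ⟨i1, i2, i3⟩ := index_of_cover h1 h2 h3' hu
      refine Set.eq_of_subset_of_ncard_le ?_ ?_ hfin
      · rintro L (rfl | rfl | rfl) <;> assumption
      · rw [h3, Set.ncard_eq_three.2 ⟨H1, H2, H3, h12, h13, h23, rfl⟩]
    exact fun S T hS hT ↦ (key S hS).trans (key T hT).symm

/-- Pulling back along a surjection with kernel of odd order preserves the number of index-two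
subgroups. -/
theorem ncard_index_two_eq_of_surjective {G' : Type*} [Group G'] {f : G →* G'}
    (hf : Function.Surjective f) (hodd : Odd (Nat.card f.ker)) :
    {H : Subgroup G | H.index = 2}.ncard = {H : Subgroup G' | H.index = 2}.ncard := by
  have hker {H : Subgroup G} (hH : H.index = 2) : f.ker ≤ H := fun x hx ↦ by
    obtain ⟨k, hk⟩ := hodd
    have hpow : x ^ (2 * k + 1) = 1 := by
      have := pow_card_eq_one' (x := (⟨x, hx⟩ : f.ker))
      rw [hk] at this
      simpa using congrArg Subtype.val this
    rw [pow_succ, pow_mul] at hpow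
    exact (mul_mem_cancel_left (pow_mem (sq_mem_of_index_two hH x) k)).1 (hpow ▸ one_mem H)
  have himage : {H : Subgroup G | H.index = 2} =
      comap f '' {H : Subgroup G' | H.index = 2} := by
    ext H
    refine ⟨fun hH ↦ ?_, ?_⟩
    · have hmap : (H.map f).comap f = H := comap_map_eq_self (hker hH)
      refine ⟨H.map f, ?_, hmap⟩
      rw [Set.mem_ofPred_eq, ← index_comap_of_surjective _ hf, hmap]
      exact hH
    · rintro ⟨K, hK, rfl⟩
      exact (index_comap_of_surjective K hf).trans hK
  rw [himage, Set.ncard_image_of_injective _ (comap_injective hf)]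

end Subgroup

open Subgroup

/-- A finite nilpotent group surjects onto each Sylow `p`-subgroup with kernel of order prime
to `p`. -/
theorem Sylow.exists_surjective_of_isNilpotent {G : Type*} [Group G] [Finite G]
    (hG : Group.IsNilpotent G) {p : ℕ} [hp : Fact p.Prime] (P : Sylow p G) :
    ∃ f : G →* P, Function.Surjective f ∧ ¬ p ∣ Nat.card f.ker := by
  obtain ⟨f, hf⟩ : ∃ f : G →* P, Function.Surjective f := by
    by_cases hdvd : p ∣ Nat.card G
    · obtain ⟨e⟩ := (Group.isNilpotent_of_finite_tfae.out 0 4).1 hG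
      let q : (Nat.card G).primeFactors :=
        ⟨p, Nat.mem_primeFactors.2 ⟨hp.out, hdvd, Nat.card_pos.ne'⟩⟩
      let π : (∀ q : (Nat.card G).primeFactors, ∀ Q : Sylow q G, (↑Q : Subgroup G)) →* P :=
        { toFun x := x q P
          map_one' := rfl
          map_mul' _ _ := rfl }
      have hπ : Function.Surjective π := fun y ↦ by
        classical
        exact ⟨Function.update 1 q (Function.update 1 P y), by simp [π]⟩
      exact ⟨π.comp e.symm.toMonoidHom, hπ.comp e.symm.surjective⟩
    · have : Nat.card P = 1 := by
        obtain ⟨n, hn⟩ := IsPGroup.iff_card.1 P.isPGroup'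
        rcases n with _ | n
        · simpa using hn
        · exact absurd ((hn ▸ dvd_pow_self p n.succ_ne_zero).trans (card_subgroup_dvd_card _)) hdvd
      have := (Nat.card_eq_one_iff_unique.1 this).1
      exact ⟨1, fun y ↦ ⟨1, Subsingleton.elim _ _⟩⟩
  refine ⟨f, hf, ?_⟩
  have h₁ : f.ker.index = Nat.card P := by
    rw [index_ker, MonoidHom.range_eq_top.2 hf, card_top]
  have h₂ := f.ker.card_mul_index
  rw [h₁, ← P.index_mul_card] at h₂
  rw [Nat.eq_of_mul_eq_mul_right Nat.card_pos h₂]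
  exact P.not_dvd_index

theorem IsPGroup.index_eq_of_isCoatom {P : Type*} [Group P] [Finite P] {p : ℕ} [Fact p.Prime]
    (hP : IsPGroup p P) {M : Subgroup P} (hM : IsCoatom M) : M.index = p := by
  obtain ⟨n, hn⟩ := IsPGroup.iff_card.1 (hP.to_subgroup M)
  obtain ⟨k, hk⟩ := hP.index M
  have hk0 : k ≠ 0 := by
    rintro rfl
    exact hM.1 (index_eq_one.1 (by simpa using hk))
  have hdvd : p ^ (n + 1) ∣ Nat.card P := by
    rw [← M.card_mul_index, hn, hk, pow_succ]
    exact mul_dvd_mul_left _ (dvd_pow_self p hk0)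
  obtain ⟨K, hK, hMK⟩ := Sylow.exists_subgroup_card_pow_succ hdvd hn
  have hp1 : 1 < p := (Fact.out : p.Prime).one_lt
  have hKtop : K = ⊤ := hM.2 K (hMK.lt_of_ne fun h ↦ by
    rw [← h, hn] at hK
    exact (Nat.pow_lt_pow_right hp1 n.lt_succ_self).ne hK)
  rw [hKtop, card_top, ← M.card_mul_index, hn, pow_succ] at hK
  exact Nat.eq_of_mul_eq_mul_left (by positivity) hK

/-- A finite `2`-group has exactly three index-two subgroups iff its Frattini subgroup has index
four. -/
theorem IsPGroup.ncard_index_two_eq_three_iff {P : Type*} [Group P] [Finite P]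
    (hP : IsPGroup 2 P) :
    {H : Subgroup P | H.index = 2}.ncard = 3 ↔ (frattini P).index = 4 := by
  have hcoatom (M : Subgroup P) : IsCoatom M ↔ M.index = 2 :=
    ⟨hP.index_eq_of_isCoatom, isCoatom_of_index_eq_two⟩
  have hle {L : Subgroup P} (hL : L.index = 2) : frattini P ≤ L :=
    frattini_le_coatom ((hcoatom L).2 hL)
  have le_frattini {D : Subgroup P} (hD : ∀ L : Subgroup P, L.index = 2 → D ≤ L) :
      D ≤ frattini P := le_iInf₂ fun L hL ↦ hD L ((hcoatom L).1 hL)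
  constructor
  · intro h3
    obtain ⟨A, B, C, hAB, hAC, hBC, hS⟩ := Set.ncard_eq_three.1 h3
    have hmem (L : Subgroup P) : L.index = 2 ↔ L = A ∨ L = B ∨ L = C := Set.ext_iff.1 hS L
    have iA : A.index = 2 := (hmem A).2 (by simp)
    have iB : B.index = 2 := (hmem B).2 (by simp)
    have hC : agreement A B iA iB = C := by
      have := (hmem _).1 (index_agreement iA iB hAB)
      have := agreement_ne_left iA iB
      have := agreement_ne_right iA iB
      tauto
    have : frattini P = A ⊓ B := by
      refine le_antisymm (le_inf (hle iA) (hle iB)) (le_frattini fun L hL ↦ ?_)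
      rcases (hmem L).1 hL with rfl | rfl | rfl
      · exact inf_le_left
      · exact inf_le_right
      · exact hC ▸ inf_le_agreement iA iB
    rw [this, index_inf_eq_four iA iB hAB]
  · intro h4
    obtain ⟨A, iA⟩ : ∃ A : Subgroup P, A.index = 2 := by
      by_contra! h
      have : ⊤ ≤ frattini P := le_frattini fun L hL ↦ absurd hL (h L)
      rw [top_le_iff.1 this, index_top] at h4
      omega
    obtain ⟨B, iB, hAB⟩ : ∃ B : Subgroup P, B.index = 2 ∧ A ≠ B := by
      by_contra! h
      have : frattini P = A := le_antisymm (hle iA) (le_frattini fun L hL ↦ (h L hL).le)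
      rw [this] at h4
      omega
    have hD : frattini P = A ⊓ B := eq_of_le_of_index_eq (le_inf (hle iA) (hle iB))
      (h4.trans (index_inf_eq_four iA iB hAB).symm) (by omega)
    refine Set.ncard_eq_three.2 ⟨A, B, agreement A B iA iB, hAB, (agreement_ne_left iA iB).symm,
      (agreement_ne_right iA iB).symm, Set.Subset.antisymm (fun L hL ↦ ?_) ?_⟩
    · exact eq_or_eq_or_eq_agreement_of_inf_le iA iB hL hAB (hD ▸ hle hL)
    · rintro L (rfl | rfl | rfl)
      · exact iA
      · exact iB
      · exact index_agreement iA iB hAB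

theorem nilpotent_unique_cover_iff_sylow_two_frattini
    (G : Type*) [Group G] [Finite G] (hG : Group.IsNilpotent G) (P : Sylow 2 G) :
    (∃! S : Set (Subgroup G),
      ∃ H1 H2 H3 : Subgroup G, S = {H1, H2, H3} ∧
        H1 ≠ H2 ∧ H1 ≠ H3 ∧ H2 ≠ H3 ∧
        H1 ≠ ⊤ ∧ H2 ≠ ⊤ ∧ H3 ≠ ⊤ ∧
        (H1 : Set G) ∪ (H2 : Set G) ∪ (H3 : Set G) = Set.univ) ↔
    ((P : Subgroup G) ≠ ⊥ ∧ (frattini (P : Subgroup G)).index = 4) := by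
  obtain ⟨f, hf, hodd⟩ := P.exists_surjective_of_isNilpotent hG
  rw [existsUnique_cover_iff_ncard_index_two_eq_three,
    ncard_index_two_eq_of_surjective hf (Nat.odd_iff.2 (Nat.two_dvd_ne_zero.1 hodd)),
    P.isPGroup'.ncard_index_two_eq_three_iff, iff_and_self]
  intro h4 hbot
  have hdvd := (frattini (P : Subgroup G)).index_dvd_card
  rw [h4, card_eq_one.2 hbot] at hdvd
  omega
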